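/- The quotient of the Lie algebra 𝒟 by the one-dimensional ideal ℂ·1 (scalar multiples of the identity operator) is a simple Lie algebra; equivalently, ℂ·1 is contained in [𝒟,𝒟], the quotient 𝒟/ℂ·1 is non-abelian, and every Lie ideal of 𝒟 containing ℂ·1 properly equals 𝒟. -/

import Mathlib

/-- The operator `z^k f(D)` on `ℂ[z,z⁻¹]` (Laurent polynomials realized as finitely
supported functions `ℤ → ℂ` on the basis `z^n ↔ single n 1`): it sends `z^n` to
`f(n)·z^{n+k}`. -/
noncomputable def opE (k : ℤ) (f : Polynomial ℂ) : Module.End ℂ (ℤ →₀ ℂ) :=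
  Finsupp.lsum ℂ fun n => Polynomial.eval ((n : ℤ) : ℂ) f • Finsupp.lsingle (n + k)

/-- The Lie algebra `𝒟` of regular differential operators on `ℂ^×`: the linear span of
the operators `z^k f(D)` in `End(ℂ[z,z⁻¹])`, with the commutator bracket. -/
noncomputable def Dcal : Submodule ℂ (Module.End ℂ (ℤ →₀ ℂ)) :=
  Submodule.span ℂ {T | ∃ (k : ℤ) (f : Polynomial ℂ), T = opE k f}

open Polynomial

lemma opE_single (k : ℤ) (f : ℂ[X]) (n : ℤ) (c : ℂ) :
    opE k f (Finsupp.single n c) = Finsupp.single (n + k) (f.eval (n : ℂ) * c) := by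
  simp [opE]

/-- `f ↦ z^k f(D)` as a linear map. -/
noncomputable def opELin (k : ℤ) : ℂ[X] →ₗ[ℂ] Module.End ℂ (ℤ →₀ ℂ) where
  toFun := opE k
  map_add' f g := by
    refine Finsupp.lhom_ext fun n c => ?_
    simp [opE_single, add_mul, Finsupp.single_add]
  map_smul' a f := by
    refine Finsupp.lhom_ext fun n c => ?_
    simp only [opE_single, LinearMap.smul_apply, RingHom.id_apply, eval_smul, smul_eq_mul,
      Finsupp.smul_single, mul_assoc]

@[simp]
lemma opELin_apply (k : ℤ) (f : ℂ[X]) : opELin k f = opE k f := rfl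

lemma opE_mem_Dcal (k : ℤ) (f : ℂ[X]) : opE k f ∈ Dcal :=
  Submodule.subset_span ⟨k, f, rfl⟩

lemma lie_opE (k l : ℤ) (f g : ℂ[X]) :
    ⁅opE k f, opE l g⁆ = opE (k + l) (taylor (l : ℂ) f * g - f * taylor (k : ℂ) g) := by
  refine Finsupp.lhom_ext fun n c => ?_
  rw [Ring.lie_def]
  simp only [LinearMap.sub_apply, Module.End.mul_apply, opE_single, eval_sub, eval_mul,
    taylor_eval, Int.cast_add, sub_mul, Finsupp.single_sub]
  rw [add_assoc n l k, add_assoc n k l, add_comm l k]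
  congr 2 <;> ring_nf

lemma lie_sum_smul_end {ι : Type*} (s : Finset ι) (T : Module.End ℂ (ℤ →₀ ℂ)) (a : ι → ℂ)
    (U : ι → Module.End ℂ (ℤ →₀ ℂ)) : ⁅T, ∑ i ∈ s, a i • U i⁆ = ∑ i ∈ s, a i • ⁅T, U i⁆ := by
  refine LinearMap.ext fun v => ?_
  simp only [Ring.lie_def, LinearMap.sub_apply, Module.End.mul_apply, LinearMap.sum_apply,
    LinearMap.smul_apply, map_sum, map_smul, smul_sub, Finset.sum_sub_distrib]

lemma opE_zero_C (a : ℂ) : opE 0 (C a) = a • 1 := by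
  refine Finsupp.lhom_ext fun n c => ?_
  simp [opE_single]

lemma exists_sum_opE_of_mem_Dcal {x : Module.End ℂ (ℤ →₀ ℂ)} (hx : x ∈ Dcal) :
    ∃ F : ℤ →₀ ℂ[X], x = ∑ k ∈ F.support, opE k (F k) := by
  have hle : Dcal ≤ LinearMap.range (Finsupp.lsum ℂ opELin) := by
    refine Submodule.span_le.2 ?_
    rintro _ ⟨k, f, rfl⟩
    exact ⟨Finsupp.single k f, by rw [Finsupp.lsum_single, opELin_apply]⟩
  obtain ⟨F, rfl⟩ := hle hx
  exact ⟨F, by simp only [Finsupp.lsum_apply, Finsupp.sum, opELin_apply]⟩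

lemma taylor_sub_self_ne_zero {r : ℂ} (hr : r ≠ 0) {f : ℂ[X]} (hf : ∀ a, f ≠ C a) :
    taylor r f - f ≠ 0 := by
  intro h
  have hper : ∀ j : ℕ, f.eval (j * r) = f.eval 0 := by
    intro j
    induction j with
    | zero => simp
    | succ j ih =>
      have := congrArg (eval (j * r)) (sub_eq_zero.1 h)
      rw [taylor_eval, ih] at this
      rw [← this]
      push_cast
      ring_nf
  refine hf (f.eval 0) (eq_of_infinite_eval_eq _ _ ?_)
  refine (Set.infinite_range_of_injective (f := fun j : ℕ => (j : ℂ) * r) ?_).mono ?_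
  · intro i j hij
    simpa [hr] using hij
  · rintro _ ⟨j, rfl⟩
    simp [hper j]

lemma degree_taylor_X_pow_sub {r : ℂ} (hr : r ≠ 0) (n : ℕ) :
    (taylor r (X ^ (n + 1)) - X ^ (n + 1) : ℂ[X]).degree = n := by
  have hlt : (taylor r (X ^ (n + 1)) - X ^ (n + 1) : ℂ[X]).degree < (n + 1 : ℕ) := by
    refine (degree_sub_lt_left (by rw [degree_taylor]) ?_ (by rw [leadingCoeff_taylor])).trans_eq ?_
    · simp only [ne_eq, taylor_eq_zero]
      exact pow_ne_zero _ X_ne_zero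
    · rw [degree_taylor, degree_X_pow]
  refine le_antisymm (Order.le_of_lt_succ ?_) (le_degree_of_ne_zero ?_)
  · exact_mod_cast hlt
  · simp [coeff_X_add_C_pow, coeff_X_pow, hr]
    norm_cast

lemma exists_taylor_sub_self_eq {r : ℂ} (hr : r ≠ 0) (f : ℂ[X]) :
    ∃ g : ℂ[X], taylor r g - g = f := by
  let S : Polynomial.Sequence ℂ :=
    ⟨fun n => taylor r (X ^ (n + 1)) - X ^ (n + 1), degree_taylor_X_pow_sub hr⟩
  have hS : Submodule.span ℂ (Set.range S) = ⊤ :=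
    S.span fun n => (leadingCoeff_ne_zero.2 (S.ne_zero n)).isUnit
  have hle : Submodule.span ℂ (Set.range S) ≤
      LinearMap.range (taylor r - LinearMap.id : ℂ[X] →ₗ[ℂ] ℂ[X]) := by
    refine Submodule.span_le.2 ?_
    rintro _ ⟨n, rfl⟩
    exact ⟨X ^ (n + 1), rfl⟩
  obtain ⟨g, hg⟩ := hle (hS ▸ Submodule.mem_top : f ∈ _)
  exact ⟨g, hg⟩

lemma sum_eval_smul_opE_mem {I : Submodule ℂ (Module.End ℂ (ℤ →₀ ℂ))}
    (hI : ∀ x ∈ Dcal, ∀ y ∈ I, ⁅x, y⁆ ∈ I) (F : ℤ →₀ ℂ[X]) (hF : ∑ k ∈ F.support, opE k (F k) ∈ I)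
    (p : ℂ[X]) : ∑ k ∈ F.support, p.eval (k : ℂ) • opE k (F k) ∈ I := by
  induction p using Polynomial.induction_on with
  | C a => simpa [← Finset.smul_sum] using I.smul_mem a hF
  | add p q hp hq => simpa [add_smul, Finset.sum_add_distrib] using I.add_mem hp hq
  | monomial n a h =>
    convert hI _ (opE_mem_Dcal 0 X) _ h using 1
    rw [lie_sum_smul_end]
    refine Finset.sum_congr rfl fun k _ => ?_
    rw [lie_opE]
    have : taylor (k : ℂ) X * F k - X * taylor ((0 : ℤ) : ℂ) (F k) = (k : ℂ) • F k := by
      simp [smul_eq_C_mul]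
      ring
    rw [this, zero_add, ← opELin_apply k ((k : ℂ) • F k), map_smul, opELin_apply, smul_smul]
    simp [pow_succ, mul_assoc]

lemma opE_component_mem {I : Submodule ℂ (Module.End ℂ (ℤ →₀ ℂ))}
    (hI : ∀ x ∈ Dcal, ∀ y ∈ I, ⁅x, y⁆ ∈ I) (F : ℤ →₀ ℂ[X]) (hF : ∑ k ∈ F.support, opE k (F k) ∈ I)
    {k : ℤ} (hk : k ∈ F.support) : opE k (F k) ∈ I := by
  have h := sum_eval_smul_opE_mem hI F hF (Lagrange.basis F.support (fun j : ℤ => (j : ℂ)) k)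
  rw [Finset.sum_eq_single_of_mem k hk] at h
  · rwa [Lagrange.eval_basis_self Int.cast_injective.injOn hk, one_smul] at h
  · intro j hj hjk
    rw [Lagrange.eval_basis_of_ne hjk.symm hj, zero_smul]

lemma opE_taylor_sub_self_mem {I : Submodule ℂ (Module.End ℂ (ℤ →₀ ℂ))}
    (hI : ∀ x ∈ Dcal, ∀ y ∈ I, ⁅x, y⁆ ∈ I) {k : ℤ} {f : ℂ[X]} (hf : opE k f ∈ I) (l : ℤ) :
    opE (l + k) (taylor (l : ℂ) f - f) ∈ I := by
  have h := I.smul_mem (-1 : ℂ) (hI _ (opE_mem_Dcal l 1) _ hf)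
  rw [lie_opE, ← opELin_apply, ← map_smul] at h
  simpa using h

lemma exists_opE_one_mem {I : Submodule ℂ (Module.End ℂ (ℤ →₀ ℂ))}
    (hI : ∀ x ∈ Dcal, ∀ y ∈ I, ⁅x, y⁆ ∈ I) {k : ℤ} (hk : k ≠ 0) {f : ℂ[X]} (hf0 : f ≠ 0)
    (hf : opE k f ∈ I) :
    ∃ m : ℤ, m ≠ 0 ∧ opE m 1 ∈ I := by
  induction hn : f.degree using WellFoundedLT.induction generalizing k f with
  | ind n ih =>
    by_cases hc : ∃ a, f = C a
    · obtain ⟨a, rfl⟩ := hc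
      have ha : a ≠ 0 := by simpa using hf0
      refine ⟨k, hk, ?_⟩
      have h := I.smul_mem a⁻¹ hf
      rw [← opELin_apply, ← map_smul] at h
      simpa [smul_C, ha] using h
    · push Not at hc
      have hk' : (k : ℂ) ≠ 0 := by exact_mod_cast hk
      refine ih _ ?_ (by omega : k + k ≠ 0) (taylor_sub_self_ne_zero hk' hc)
        (opE_taylor_sub_self_mem hI hf k) rfl
      rw [← hn, ← degree_taylor f (k : ℂ)]
      exact degree_sub_lt_left (by simp) (by simpa using hf0) (by simp)

lemma Dcal_le_of_opE_one_mem {I : Submodule ℂ (Module.End ℂ (ℤ →₀ ℂ))}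
    (hI : ∀ x ∈ Dcal, ∀ y ∈ I, ⁅x, y⁆ ∈ I) {m : ℤ} (hm : m ≠ 0) (h1 : opE m 1 ∈ I) : Dcal ≤ I := by
  refine Submodule.span_le.2 ?_
  rintro _ ⟨k, f, rfl⟩
  obtain ⟨g, rfl⟩ := exists_taylor_sub_self_eq (r := (m : ℂ)) (by exact_mod_cast hm) f
  simpa [lie_opE] using hI _ (opE_mem_Dcal (k - m) g) _ h1

lemma Dcal_le_of_notMem_span_one {I : Submodule ℂ (Module.End ℂ (ℤ →₀ ℂ))}
    (hI : ∀ x ∈ Dcal, ∀ y ∈ I, ⁅x, y⁆ ∈ I) {x : Module.End ℂ (ℤ →₀ ℂ)}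
    (hxD : x ∈ Dcal) (hxI : x ∈ I)
    (hx : x ∉ Submodule.span ℂ {(1 : Module.End ℂ (ℤ →₀ ℂ))}) : Dcal ≤ I := by
  obtain ⟨F, rfl⟩ := exists_sum_opE_of_mem_Dcal hxD
  obtain ⟨k, hk, hkF⟩ : ∃ k ∈ F.support,
      opE k (F k) ∉ Submodule.span ℂ {(1 : Module.End ℂ (ℤ →₀ ℂ))} := by
    by_contra! h
    exact hx (Submodule.sum_mem _ h)
  have hmem := opE_component_mem hI F hxI hk
  suffices ∃ m : ℤ, m ≠ 0 ∧ opE m 1 ∈ I by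
    obtain ⟨m, hm, h1⟩ := this
    exact Dcal_le_of_opE_one_mem hI hm h1
  rcases eq_or_ne k 0 with rfl | hk0
  · refine exists_opE_one_mem hI (one_ne_zero) (taylor_sub_self_ne_zero (r := 1) one_ne_zero ?_)
      (by simpa using opE_taylor_sub_self_mem hI hmem 1)
    intro a ha
    rw [ha, opE_zero_C] at hkF
    exact hkF (Submodule.smul_mem _ _ (Submodule.mem_span_singleton_self _))
  · exact exists_opE_one_mem hI hk0 (Finsupp.mem_support_iff.1 hk) hmem

/-- The Lie algebra `𝒟/ℂ·1` is simple; equivalently: `ℂ·1 ⊆ [𝒟,𝒟]`, the quotient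
`𝒟/ℂ·1` is non-abelian, and every Lie ideal of `𝒟` containing `ℂ·1` properly equals
`𝒟`. -/
theorem Dcal_mod_scalars_is_simple :
    -- `ℂ·1 ⊆ [𝒟,𝒟]`
    ((1 : Module.End ℂ (ℤ →₀ ℂ)) ∈
      Submodule.span ℂ {w : Module.End ℂ (ℤ →₀ ℂ) | ∃ x ∈ Dcal, ∃ y ∈ Dcal, w = ⁅x, y⁆}) ∧
    -- the quotient `𝒟/ℂ·1` is non-abelian
    (∃ x ∈ Dcal, ∃ y ∈ Dcal,
      ⁅x, y⁆ ∉ Submodule.span ℂ {(1 : Module.End ℂ (ℤ →₀ ℂ))}) ∧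
    -- every Lie ideal of `𝒟` containing `ℂ·1` properly equals `𝒟`
    (∀ I : Submodule ℂ (Module.End ℂ (ℤ →₀ ℂ)),
      I ≤ Dcal →
      (∀ x ∈ Dcal, ∀ y ∈ I, ⁅x, y⁆ ∈ I) →
      (1 : Module.End ℂ (ℤ →₀ ℂ)) ∈ I →
      (∃ x ∈ I, x ∉ Submodule.span ℂ {(1 : Module.End ℂ (ℤ →₀ ℂ))}) →
      I = Dcal) := by
  refine ⟨Submodule.subset_span ⟨_, opE_mem_Dcal 1 1, _, opE_mem_Dcal (-1) (-X), ?_⟩,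
    ⟨_, opE_mem_Dcal 0 X, _, opE_mem_Dcal 1 1, ?_⟩, ?_⟩
  · rw [lie_opE]
    have : taylor ((-1 : ℤ) : ℂ) 1 * -X - 1 * taylor ((1 : ℤ) : ℂ) (-X) = (C 1 : ℂ[X]) := by
      simp
    rw [this, add_neg_cancel, opE_zero_C, one_smul]
  · rw [lie_opE, Submodule.mem_span_singleton]
    rintro ⟨a, ha⟩
    have h := congrArg (fun T => T (Finsupp.single 0 1) 1) ha
    simp [opE_single] at h
  · rintro I hID hI - ⟨x, hxI, hx⟩
    exact le_antisymm hID (Dcal_le_of_notMem_span_one hI (hID hxI) hxI hx)
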